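/- Let P = σ̄∖L be a relative n-simplex, where σ̄ is the complex of all subsets of an (n+1)-element set σ and L is the subcomplex generated by finitely many proper faces of σ. Then the first barycentric subdivision Sd(P) = Sd(σ̄)∖Sd(L) carries a shellable Morse tiling. Moreover, this tiling uses a Morse tile of order 0 if and only if no ridge of σ (face of cardinality n) belongs to L, it uses a Morse tile of order n+1 (an open simplex) if and only if every ridge of σ belongs to L, and in each case such a tile is unique. -/

import Mathlib

open Finset

variable {V : Type*} [DecidableEq V]

/-- A finite simplicial complex: a finite collection of finite sets of vertices
closed under taking subsets. -/
def IsComplex (K : Finset (Finset V)) : Prop :=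
  ∀ σ ∈ K, ∀ τ ⊆ σ, τ ∈ K

/-- The set of nonempty faces of the relative simplicial complex `K ∖ L`. -/
def relFaces (K L : Finset (Finset V)) : Finset (Finset V) :=
  (K \ L).filter (fun τ => τ ≠ ∅)

/-- A set `A` of faces is closed in `S`: every nonempty face of `S` contained in a
member of `A` belongs to `A`. -/
def closedIn (S A : Finset (Finset V)) : Prop :=
  ∀ τ ∈ S, τ ≠ ∅ → ∀ α ∈ A, τ ⊆ α → τ ∈ A

/-- A facet: a maximal face. -/
def IsFacetOf (K : Finset (Finset V)) (θ : Finset V) : Prop :=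
  θ ∈ K ∧ ∀ σ ∈ K, θ ⊆ σ → σ = θ

instance (K : Finset (Finset V)) (θ : Finset V) : Decidable (IsFacetOf K θ) :=
  inferInstanceAs (Decidable (θ ∈ K ∧ ∀ σ ∈ K, θ ⊆ σ → σ = θ))

/-- A ridge: a face of codimension one in every facet containing it. -/
def IsRidgeOf (K : Finset (Finset V)) (θ : Finset V) : Prop :=
  θ ∈ K ∧ ∀ σ, IsFacetOf K σ → θ ⊆ σ → σ.card = θ.card + 1

/-- Stellar subdivision of `K` at the face `θ`, using the new vertex `v`. -/
def stellar (K : Finset (Finset V)) (θ : Finset V) (v : V) : Finset (Finset V) :=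
  K.filter (fun σ => ¬ θ ⊆ σ) ∪
    (K.filter (fun ρ => ¬ θ ⊆ ρ ∧ ρ ∪ θ ∈ K)).image (fun ρ => insert v ρ)

/-- Barycentric subdivision: faces are the chains of nonempty faces of `K`. -/
def barySd (K : Finset (Finset V)) : Finset (Finset (Finset V)) :=
  K.powerset.filter (fun c => ∅ ∉ c ∧ ∀ τ ∈ c, ∀ τ' ∈ c, τ ⊆ τ' ∨ τ' ⊆ τ)

/-- A Morse tile: a simplex `simplex` deprived of the ridges not containing `res`,
together possibly with a Morse face `morse` of higher codimension. -/
structure MorseTile (V : Type*) where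
  simplex : Finset V
  res : Finset V
  morse : Option (Finset V)
  simplex_nonempty : simplex.Nonempty
  res_sub : res ⊆ simplex
  morse_res : ∀ μ ∈ morse, res ⊆ μ
  morse_ssub : ∀ μ ∈ morse, μ ⊂ simplex
  morse_card : ∀ μ ∈ morse, μ.card + 2 ≤ simplex.card

namespace MorseTile

/-- The face set of a Morse tile. -/
def faceSet (T : MorseTile V) : Finset (Finset V) :=
  match T.morse with
  | none => T.simplex.powerset.filter (fun τ => T.res ⊆ τ ∧ τ ≠ ∅)
  | some μ => T.simplex.powerset.filter (fun τ => T.res ⊆ τ ∧ ¬ τ ⊆ μ)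

/-- The dimension of a Morse tile. -/
def dim (T : MorseTile V) : ℕ := T.simplex.card - 1

/-- The order of a Morse tile. -/
def order (T : MorseTile V) : ℕ := T.res.card

/-- The index of a (critical) Morse tile. -/
def index (T : MorseTile V) : ℕ :=
  if T.res = T.simplex then T.simplex.card - 1 else T.res.card

/-- Basic tiles: no Morse face. -/
def IsBasic (T : MorseTile V) : Prop := T.morse = none

/-- Critical tiles: the Morse face equals the restriction set, or the open simplex. -/
def IsCritical (T : MorseTile V) : Prop := T.morse = some T.res ∨ T.res = T.simplex

/-- Tiles allowed in an h-tiling: basic or critical tiles. -/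
def IsHTile (T : MorseTile V) : Prop := T.morse = none ∨ T.morse = some T.res

/-- The closed simplex. -/
def IsClosedSimplex (T : MorseTile V) : Prop := T.morse = none ∧ T.res = ∅

/-- The open simplex. -/
def IsOpenSimplex (T : MorseTile V) : Prop := T.morse = none ∧ T.res = T.simplex

instance (T : MorseTile V) : Decidable T.IsCritical :=
  inferInstanceAs (Decidable (T.morse = some T.res ∨ T.res = T.simplex))

/-- Isomorphism of Morse tiles: a bijection between the underlying simplices mapping
the face set of one onto the face set of the other. -/
def Isom (T T' : MorseTile V) : Prop :=
  ∃ e : V → V, Set.InjOn e (T.simplex : Set V) ∧ T.simplex.image e = T'.simplex ∧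
    T.faceSet.image (fun τ => τ.image e) = T'.faceSet

/-- The subcomplex `L_T` of removed faces of a Morse tile. -/
def removed (T : MorseTile V) : Finset (Finset V) :=
  T.simplex.powerset.filter (fun τ => τ ∉ T.faceSet)

/-- The stellar subdivision of a Morse tile at a face `θ` of its underlying simplex,
as a relative simplicial complex. -/
def stellarSub (T : MorseTile V) (θ : Finset V) (v : V) : Finset (Finset V) :=
  relFaces (stellar T.simplex.powerset θ v) (stellar T.removed θ v)

end MorseTile

/-- The union of the face sets of a list of Morse tiles. -/
def faceUnion (ts : List (MorseTile V)) : Finset (Finset V) :=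
  ts.foldr (fun T A => T.faceSet ∪ A) ∅

/-- A Morse tiling of the set `S` of nonempty faces of a relative complex:
the face sets of the tiles partition `S`, and for every `d` the union of the
face sets of the tiles of dimension at least `d` is closed in `S`. -/
def IsMorseTiling (S : Finset (Finset V)) (ts : List (MorseTile V)) : Prop :=
  ts.Pairwise (fun T T' => Disjoint T.faceSet T'.faceSet) ∧
  faceUnion ts = S ∧
  ∀ d : ℕ, closedIn S (faceUnion (ts.filter (fun T => decide (d ≤ T.dim))))

/-- A Morse shelling: a Morse tiling whose order makes every initial union closed. -/
def IsMorseShelling (S : Finset (Finset V)) (ts : List (MorseTile V)) : Prop :=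
  IsMorseTiling S ts ∧ ∀ p : ℕ, closedIn S (faceUnion (ts.take p))

/-- An h-tiling: a Morse tiling all of whose tiles are basic or critical. -/
def IsHTiling (S : Finset (Finset V)) (ts : List (MorseTile V)) : Prop :=
  IsMorseTiling S ts ∧ ∀ T ∈ ts, T.IsHTile

/-- A shellable (shelled) h-tiling. -/
def IsHShelling (S : Finset (Finset V)) (ts : List (MorseTile V)) : Prop :=
  IsMorseShelling S ts ∧ ∀ T ∈ ts, T.IsHTile

/-- The number of critical tiles of index `k`. -/
def criticalCount (ts : List (MorseTile V)) (k : ℕ) : ℕ :=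
  ts.countP (fun T => decide (T.IsCritical ∧ T.index = k))

/-- The total number of critical tiles. -/
def totalCritical (ts : List (MorseTile V)) : ℕ :=
  ts.countP (fun T => decide T.IsCritical)

/-- The number of tiles of order `k`. -/
def hCount (ts : List (MorseTile V)) (k : ℕ) : ℕ :=
  ts.countP (fun T => decide (T.order = k))

/-- The number of `k`-dimensional faces. -/
def fCount (S : Finset (Finset V)) (k : ℕ) : ℕ :=
  (S.filter (fun τ => τ.card = k + 1)).card

/-- The Euler characteristic of a set of nonempty faces. -/
def eulerChar (S : Finset (Finset V)) : ℤ :=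
  ∑ τ ∈ S, (-1 : ℤ) ^ (τ.card - 1)

/-- A pure `n`-dimensional complex: it has an `n`-dimensional face and all its
facets have dimension `n`. -/
def IsPureDim (n : ℕ) (K : Finset (Finset V)) : Prop :=
  (∃ σ ∈ K, σ.card = n + 1) ∧ ∀ θ, IsFacetOf K θ → θ.card = n + 1

/-- A closed `n`-dimensional pseudo-manifold: a pure `n`-dimensional complex in
which every `(n-1)`-dimensional face is contained in exactly two facets. -/
def IsPseudoManifold (n : ℕ) (K : Finset (Finset V)) : Prop :=
  IsComplex K ∧ IsPureDim n K ∧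
  ∀ ρ ∈ K, ρ.card = n → (K.filter (fun σ => IsFacetOf K σ ∧ ρ ⊆ σ)).card = 2

/-- Strong connectedness: any two facets are joined by a sequence of facets in which
consecutive ones share an `(n-1)`-dimensional face. -/
def StronglyConnected (n : ℕ) (K : Finset (Finset V)) : Prop :=
  ∀ σ σ', IsFacetOf K σ → IsFacetOf K σ' →
    ∃ (m : ℕ) (c : ℕ → Finset V), c 0 = σ ∧ c m = σ' ∧
      (∀ i ≤ m, IsFacetOf K (c i)) ∧
      ∀ i < m, ∃ ρ : Finset V, ρ.card = n ∧ ρ ⊆ c i ∧ ρ ⊆ c (i + 1)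

/-- Classical shellability of a finite simplicial complex. -/
def ClassicallyShellable (K : Finset (Finset V)) : Prop :=
  ∃ (N : ℕ) (f : Fin N → Finset V), Function.Injective f ∧
    (∀ σ, IsFacetOf K σ ↔ ∃ i, f i = σ) ∧
    ∀ p : Fin N, 0 < (p : ℕ) →
      ∃ R : Finset V, R ≠ ∅ ∧ R ⊆ f p ∧
        ∀ τ : Finset V,
          ((τ ≠ ∅ ∧ τ ⊆ f p ∧ ∀ q, q < p → ¬ τ ⊆ f q) ↔ (R ⊆ τ ∧ τ ⊆ f p))

section Words

variable {α : Type*} [LinearOrder α]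

/-- The maximal chain of faces attached to a word: the supports of its nonempty suffixes. -/
def wordFlag : List α → Finset (Finset α)
  | [] => ∅
  | a :: l => insert (a :: l).toFinset (wordFlag l)

/-- The supports of the suffixes of a word that start just after a descent. -/
def wordDescents : List α → Finset (Finset α)
  | [] => ∅
  | [_] => ∅
  | a :: b :: l =>
    if b < a then insert (b :: l).toFinset (wordDescents (b :: l)) else wordDescents (b :: l)

theorem subset_of_mem_wordFlag {l : List α} {A : Finset α} (hA : A ∈ wordFlag l) :
    A ⊆ l.toFinset := by
  induction l with
  | nil => simp [wordFlag] at hA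
  | cons a l ih =>
    rcases mem_insert.1 hA with rfl | h
    · exact Subset.rfl
    · exact (ih h).trans (by simp [subset_insert])

theorem toFinset_mem_wordFlag {l : List α} (hl : l ≠ []) : l.toFinset ∈ wordFlag l := by
  cases l with
  | nil => exact absurd rfl hl
  | cons a l => simp [wordFlag]

theorem empty_notMem_wordFlag (l : List α) : ∅ ∉ wordFlag l := by
  induction l with
  | nil => simp [wordFlag]
  | cons a l ih => simpa [wordFlag, ih] using (insert_ne_empty a l.toFinset).symm

theorem wordFlag_isChain (l : List α) :
    ∀ A ∈ wordFlag l, ∀ B ∈ wordFlag l, A ⊆ B ∨ B ⊆ A := by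
  induction l with
  | nil => simp [wordFlag]
  | cons a l ih =>
    intro A hA B hB
    rcases mem_insert.1 hA with rfl | hA'
    · exact .inr (subset_of_mem_wordFlag hB)
    rcases mem_insert.1 hB with rfl | hB'
    · exact .inl (subset_of_mem_wordFlag hA)
    exact ih A hA' B hB'

theorem toFinset_cons_notMem_wordFlag {a : α} {l : List α} (h : a ∉ l) :
    (a :: l).toFinset ∉ wordFlag l := fun hm =>
  h (List.mem_toFinset.1 (subset_of_mem_wordFlag hm (by simp)))

theorem card_wordFlag {l : List α} (hl : l.Nodup) : #(wordFlag l) = l.length := by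
  induction l with
  | nil => rfl
  | cons a l ih =>
    obtain ⟨h, hl⟩ := List.nodup_cons.1 hl
    rw [wordFlag, card_insert_of_notMem (toFinset_cons_notMem_wordFlag h), ih hl,
      List.length_cons]

theorem wordDescents_subset_wordFlag_tail (l : List α) : wordDescents l ⊆ wordFlag l.tail := by
  induction l with
  | nil => simp [wordDescents]
  | cons a l ih =>
    cases l with
    | nil => simp [wordDescents]
    | cons b l =>
      have h : wordDescents (b :: l) ⊆ wordFlag (b :: l) :=
        ih.trans (by simp [wordFlag, subset_insert])
      rw [wordDescents]
      split_ifs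
      · exact insert_subset (by simp [wordFlag]) h
      · exact h

theorem wordFlag_tail_subset (l : List α) : wordFlag l.tail ⊆ wordFlag l := by
  cases l with
  | nil => exact Subset.rfl
  | cons a l => simp [wordFlag, subset_insert]

theorem wordDescents_subset_wordFlag (l : List α) : wordDescents l ⊆ wordFlag l :=
  (wordDescents_subset_wordFlag_tail l).trans (wordFlag_tail_subset l)

theorem wordDescents_subset_cons (a : α) (l : List α) :
    wordDescents l ⊆ wordDescents (a :: l) := by
  cases l with
  | nil => simp [wordDescents]
  | cons b l =>
    conv_rhs => rw [wordDescents]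
    split_ifs
    · exact subset_insert _ _
    · exact Subset.rfl

/-- Exchanging the two letters of a descent gives a smaller word whose flag differs only there. -/
theorem exists_lt_of_mem_wordDescents {l : List α} {A : Finset α} (hA : A ∈ wordDescents l) :
    ∃ l' : List α, l' < l ∧ l'.Perm l ∧ (wordFlag l).erase A ⊆ wordFlag l' := by
  induction l with
  | nil => simp [wordDescents] at hA
  | cons a l ih =>
    cases l with
    | nil => simp [wordDescents] at hA
    | cons b l =>
      by_cases h : A ∈ wordDescents (b :: l)
      · obtain ⟨l', hlt, hp, hs⟩ := ih h
        refine ⟨a :: l', List.cons_lt_cons_iff.2 (.inr ⟨rfl, hlt⟩), hp.cons a, ?_⟩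
        intro B hB
        obtain ⟨hBA, hB⟩ := mem_erase.1 hB
        rcases mem_insert.1 hB with rfl | hB
        · rw [List.toFinset_eq_of_perm _ _ (hp.symm.cons a)]
          exact toFinset_mem_wordFlag (by simp)
        · exact mem_insert_of_mem (hs (mem_erase.2 ⟨hBA, hB⟩))
      · rw [wordDescents] at hA
        split_ifs at hA with hba
        · have hA' : A = (b :: l).toFinset := (mem_insert.1 hA).resolve_right h
          refine ⟨b :: a :: l, List.cons_lt_cons_iff.2 (.inl hba), List.Perm.swap a b l, ?_⟩
          intro B hB
          obtain ⟨hBA, hB⟩ := mem_erase.1 hB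
          rcases mem_insert.1 hB with rfl | hB
          · rw [List.toFinset_eq_of_perm _ _ (List.Perm.swap b a l)]
            exact toFinset_mem_wordFlag (by simp)
          · rcases mem_insert.1 hB with rfl | hB
            · exact absurd hA'.symm hBA
            · exact mem_insert_of_mem (mem_insert_of_mem hB)
        · exact absurd hA h

theorem exists_mem_wordDescents_of_lt_head {a c : α} {l : List α} (hc : c ∈ l) (h : c < a) :
    ∃ A ∈ wordDescents (a :: l), c ∈ A := by
  induction l generalizing a with
  | nil => simp at hc
  | cons b l ih =>
    by_cases hba : b < a
    · exact ⟨(b :: l).toFinset, by simp [wordDescents, hba], by simpa using hc⟩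
    · have hcb : c < b := h.trans_le (not_lt.1 hba)
      obtain ⟨A, hA, hcA⟩ := ih ((List.mem_cons.1 hc).resolve_left hcb.ne) hcb
      exact ⟨A, wordDescents_subset_cons _ _ hA, hcA⟩

/-- Every flag that contains the descents of a word belongs to a larger word. -/
theorem exists_mem_wordDescents_notMem_wordFlag {l l' : List α} (hl : l.Nodup)
    (hp : l'.Perm l) (hlt : l' < l) : ∃ A ∈ wordDescents l, A ∉ wordFlag l' := by
  induction l generalizing l' with
  | nil => simp at hlt
  | cons a l ih =>
    cases l' with
    | nil => simpa using hp.length_eq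
    | cons c m =>
      obtain ⟨hal, hl'⟩ := List.nodup_cons.1 hl
      rcases List.cons_lt_cons_iff.1 hlt with hca | ⟨rfl, hml⟩
      · have hc : c ∈ l := (List.mem_cons.1 (hp.subset (by simp))).resolve_left hca.ne
        obtain ⟨A, hA, hcA⟩ := exists_mem_wordDescents_of_lt_head hc hca
        refine ⟨A, hA, fun hAm => ?_⟩
        rcases mem_insert.1 hAm with rfl | hAm
        · refine hal ?_
          have := subset_of_mem_wordFlag (wordDescents_subset_wordFlag_tail _ hA)
            (List.mem_toFinset.2 (hp.symm.subset (List.mem_cons_self (a := a))))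
          simpa using this
        · exact (List.nodup_cons.1 (hp.nodup_iff.2 hl)).1
            (List.mem_toFinset.1 (subset_of_mem_wordFlag hAm hcA))
      · obtain ⟨A, hA, hAm⟩ := ih hl' hp.cons_inv hml
        refine ⟨A, wordDescents_subset_cons _ _ hA, fun hAc => ?_⟩
        rcases mem_insert.1 hAc with rfl | hAc
        · exact toFinset_cons_notMem_wordFlag hal
            (by
              rw [List.toFinset_eq_of_perm _ _ hp] at hA
              exact wordDescents_subset_wordFlag _ hA)
        · exact hAm hAc

theorem le_of_wordDescents_subset {l l' : List α} (hl : l.Nodup) (hp : l'.Perm l)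
    (h : wordDescents l ⊆ wordFlag l') : l ≤ l' := by
  by_contra hlt
  obtain ⟨A, hA, hA'⟩ := exists_mem_wordDescents_notMem_wordFlag hl hp (not_le.1 hlt)
  exact hA' (h hA)

theorem pairwise_gt_of_wordFlag_tail_subset {l : List α} (hl : l.Nodup)
    (h : wordFlag l.tail ⊆ wordDescents l) : l.Pairwise (· > ·) := by
  rw [← List.isChain_iff_pairwise]
  induction l with
  | nil => simp
  | cons a l ih =>
    cases l with
    | nil => simp
    | cons b l =>
      obtain ⟨-, hl'⟩ := List.nodup_cons.1 hl
      have hb : (b :: l).toFinset ∉ wordDescents (b :: l) := fun hm =>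
        toFinset_cons_notMem_wordFlag (List.nodup_cons.1 hl').1
          (wordDescents_subset_wordFlag_tail _ hm)
      have hba : b < a := by
        by_contra hba
        refine hb ?_
        have := h (toFinset_mem_wordFlag (l := b :: l) (by simp))
        rwa [wordDescents, if_neg hba] at this
      refine List.isChain_cons_cons.2 ⟨hba, ih hl' fun B hB => ?_⟩
      have hBD := h (mem_insert_of_mem hB)
      rw [wordDescents, if_pos hba] at hBD
      refine (mem_insert.1 hBD).resolve_left ?_
      rintro rfl
      exact toFinset_cons_notMem_wordFlag (List.nodup_cons.1 hl').1 hB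

theorem wordDescents_eq_of_pairwise_gt {l : List α} (h : l.Pairwise (· > ·)) :
    wordDescents l = wordFlag l.tail := by
  induction l with
  | nil => rfl
  | cons a l ih =>
    cases l with
    | nil => rfl
    | cons b l =>
      obtain ⟨ha, hl⟩ := List.pairwise_cons.1 h
      rw [wordDescents, if_pos (ha b (by simp)), ih hl]
      rfl

theorem wordDescents_eq_empty_of_pairwise_lt {l : List α} (h : l.Pairwise (· < ·)) :
    wordDescents l = ∅ := by
  induction l with
  | nil => rfl
  | cons a l ih =>
    cases l with
    | nil => rfl
    | cons b l =>
      obtain ⟨ha, hl⟩ := List.pairwise_cons.1 h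
      rw [wordDescents, if_neg (ha b (by simp)).not_gt, ih hl]

/-- Every chain of nonempty faces extends to the flag of a word. -/
theorem exists_word_of_isChain {σ : Finset α} {c : Finset (Finset α)} (hc : c ⊆ σ.powerset)
    (h0 : ∅ ∉ c) (hch : ∀ τ ∈ c, ∀ τ' ∈ c, τ ⊆ τ' ∨ τ' ⊆ τ) :
    ∃ l : List α, l.Nodup ∧ l.toFinset = σ ∧ c ⊆ wordFlag l := by
  induction hn : #σ generalizing σ c with
  | zero =>
    obtain rfl := card_eq_zero.1 hn
    refine ⟨[], by simp, by simp, fun A hA => absurd ?_ h0⟩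
    rwa [← subset_empty.1 (mem_powerset.1 (hc hA))]
  | succ n ih =>
    obtain ⟨a, ha, hac⟩ : ∃ a ∈ σ, ∀ A ∈ c.erase σ, a ∉ A := by
      rcases (c.erase σ).eq_empty_or_nonempty with he | hne
      · obtain ⟨a, ha⟩ := card_pos.1 (n.succ_pos.trans_eq hn.symm)
        exact ⟨a, ha, by simp [he]⟩
      · obtain ⟨B, hB, hmax⟩ := exists_max_image _ card hne
        obtain ⟨hBσ, hBc⟩ := mem_erase.1 hB
        obtain ⟨a, ha, haB⟩ := exists_of_ssubset ((mem_powerset.1 (hc hBc)).ssubset_of_ne hBσ)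
        refine ⟨a, ha, fun A hA haA => haB ?_⟩
        rcases hch A (mem_erase.1 hA).2 B hBc with h | h
        · exact h haA
        · rwa [eq_of_subset_of_card_le h (hmax A hA)]
    obtain ⟨l, hl, hlσ, hcl⟩ := ih (σ := σ.erase a) (c := c.erase σ)
      (fun A hA => mem_powerset.2 (subset_erase.2
        ⟨mem_powerset.1 (hc (mem_erase.1 hA).2), hac A hA⟩))
      (fun h => h0 (mem_erase.1 h).2)
      (fun τ hτ τ' hτ' => hch τ (mem_erase.1 hτ).2 τ' (mem_erase.1 hτ').2)
      (by rw [card_erase_of_mem ha, hn]; rfl)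
    have hσ : (a :: l).toFinset = σ := by rw [List.toFinset_cons, hlσ, insert_erase ha]
    refine ⟨a :: l, List.nodup_cons.2 ⟨?_, hl⟩, hσ, fun A hA => ?_⟩
    · rw [← List.mem_toFinset, hlσ]
      exact notMem_erase a σ
    · rw [wordFlag, hσ]
      by_cases hAσ : A = σ
      · exact hAσ ▸ mem_insert_self _ _
      · exact mem_insert_of_mem (hcl (mem_erase.2 ⟨hAσ, hA⟩))

end Words

theorem mem_barySd {α : Type*} [DecidableEq α] {K : Finset (Finset α)} {c : Finset (Finset α)} :
    c ∈ barySd K ↔ c ⊆ K ∧ ∅ ∉ c ∧ ∀ τ ∈ c, ∀ τ' ∈ c, τ ⊆ τ' ∨ τ' ⊆ τ := by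
  simp [barySd]

theorem mem_faceUnion {α : Type*} [DecidableEq α] {ts : List (MorseTile α)} {τ : Finset α} :
    τ ∈ faceUnion ts ↔ ∃ T ∈ ts, τ ∈ T.faceSet := by
  induction ts with
  | nil => simp [faceUnion]
  | cons T ts ih =>
    rw [List.exists_mem_cons_iff, ← ih]
    exact mem_union

section Tiles

variable {α : Type*} [LinearOrder α]

/-- The part of the tile `[wordDescents l, wordFlag l]` outside `barySd L` is a Morse tile. -/
theorem exists_morseTile_of_word {L : Finset (Finset α)} (hL : IsComplex L) {l : List α}
    (hne : l ≠ []) (hl : l.Nodup) (hlL : l.toFinset ∉ L) :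
    ∃ T : MorseTile (Finset α), T.simplex = wordFlag l ∧
      T.res = (if l.tail.toFinset ∈ L then insert l.toFinset (wordDescents l)
        else wordDescents l) ∧
      ∀ τ, τ ∈ T.faceSet ↔ wordDescents l ⊆ τ ∧ τ ⊆ wordFlag l ∧ τ ≠ ∅ ∧ ¬ τ ⊆ L := by
  have hmem := toFinset_mem_wordFlag hne
  have hflag : ∀ A ∈ wordFlag l, A = l.toFinset ∨ A ∈ wordFlag l.tail := by
    cases l with
    | nil => exact absurd rfl hne
    | cons a l => exact fun A hA => mem_insert.1 hA
  by_cases hr : l.tail.toFinset ∈ L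
  · refine ⟨⟨wordFlag l, insert l.toFinset (wordDescents l), none, ⟨_, hmem⟩,
      insert_subset hmem (wordDescents_subset_wordFlag l), by simp, by simp, by simp⟩,
      rfl, by rw [if_pos hr], fun τ => ?_⟩
    simp only [MorseTile.faceSet, mem_filter, mem_powerset, insert_subset_iff]
    constructor
    · rintro ⟨h1, ⟨h2, h3⟩, h4⟩
      exact ⟨h3, h1, h4, fun h => hlL (h h2)⟩
    · rintro ⟨h1, h2, h3, h4⟩
      refine ⟨h2, ⟨?_, h1⟩, h3⟩
      by_contra h
      refine h4 fun A hA => ?_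
      rcases hflag A (h2 hA) with rfl | h'
      · exact absurd hA h
      · exact hL _ hr _ (subset_of_mem_wordFlag h')
  · by_cases hm : ((wordFlag l).filter (· ∈ L)).Nonempty ∧
        wordDescents l ⊆ (wordFlag l).filter (· ∈ L)
    · have hcard : #((wordFlag l).filter (· ∈ L)) + 2 ≤ #(wordFlag l) := by
        cases l with
        | nil => exact absurd rfl hne
        | cons a l =>
          obtain ⟨ha, hl'⟩ := List.nodup_cons.1 hl
          have hsub : (wordFlag (a :: l)).filter (· ∈ L) ⊆ (wordFlag l).erase l.toFinset := by
            intro A hA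
            obtain ⟨hA, hAL⟩ := mem_filter.1 hA
            refine mem_erase.2 ⟨fun h => hr (by simpa [← h] using hAL), ?_⟩
            rcases mem_insert.1 hA with rfl | hA
            · exact absurd hAL hlL
            · exact hA
          have hl0 : l ≠ [] := by
            rintro rfl
            obtain ⟨A, hA⟩ := hm.1
            simpa [wordFlag] using hsub hA
          have h1 := card_le_card hsub
          rw [card_erase_of_mem (toFinset_mem_wordFlag hl0), card_wordFlag hl'] at h1
          have h2 := List.length_pos_iff.2 hl0
          rw [card_wordFlag hl, List.length_cons]
          omega
      refine ⟨⟨wordFlag l, wordDescents l, some ((wordFlag l).filter (· ∈ L)), ⟨_, hmem⟩,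
        wordDescents_subset_wordFlag l, ?_, ?_, ?_⟩, rfl, by rw [if_neg hr], fun τ => ?_⟩
      · rintro μ ⟨⟩
        exact hm.2
      · rintro μ ⟨⟩
        exact filter_ssubset.2 ⟨_, hmem, hlL⟩
      · rintro μ ⟨⟩
        exact hcard
      · simp only [MorseTile.faceSet, mem_filter, mem_powerset]
        constructor
        · rintro ⟨h1, h2, h3⟩
          refine ⟨h2, h1, ?_, fun h => h3 fun A hA => mem_filter.2 ⟨h1 hA, h hA⟩⟩
          rintro rfl
          exact h3 (empty_subset _)
        · rintro ⟨h1, h2, -, h4⟩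
          exact ⟨h2, h1, fun h => h4 fun A hA => (mem_filter.1 (h hA)).2⟩
    · refine ⟨⟨wordFlag l, wordDescents l, none, ⟨_, hmem⟩,
        wordDescents_subset_wordFlag l, by simp, by simp, by simp⟩, rfl, by rw [if_neg hr],
        fun τ => ?_⟩
      simp only [MorseTile.faceSet, mem_filter, mem_powerset]
      constructor
      · rintro ⟨h1, h2, h3⟩
        refine ⟨h2, h1, h3, fun h => hm ?_⟩
        have hτ : τ ⊆ (wordFlag l).filter (· ∈ L) := fun A hA => mem_filter.2 ⟨h1 hA, h hA⟩
        exact ⟨(nonempty_iff_ne_empty.2 h3).mono hτ, h2.trans hτ⟩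
      · rintro ⟨h1, h2, h3, -⟩
        exact ⟨h2, h1, h3⟩

/-- The words of a finite set, in increasing lexicographic order. -/
theorem exists_sorted_words (σ : Finset α) :
    ∃ W : List (List α), W.Pairwise (· < ·) ∧ ∀ l, l ∈ W ↔ l.Nodup ∧ l.toFinset = σ := by
  refine ⟨(σ.toList.permutations.toFinset).sort, (sortedLT_sort _).pairwise, fun l => ?_⟩
  rw [mem_sort, List.mem_toFinset, List.mem_permutations]
  constructor
  · intro h
    exact ⟨h.nodup_iff.2 σ.nodup_toList, by rw [List.toFinset_eq_of_perm _ _ h, toList_toFinset]⟩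
  · rintro ⟨h, rfl⟩
    exact (List.perm_of_nodup_nodup_toFinset_eq h (nodup_toList _) (by simp))

theorem barySd_simplex_morseShelling (n : ℕ) (σ : Finset α) (hσ : #σ = n + 1)
    (L : Finset (Finset α)) (hL : IsComplex L) (hLp : σ ∉ L)
    (hlt : ∀ a b, σ.erase a ∈ L → σ.erase b ∉ L → a < b) :
    ∃ ts : List (MorseTile (Finset α)),
      IsMorseShelling (relFaces (barySd σ.powerset) (barySd L)) ts ∧
      ((∃ T ∈ ts, T.order = 0) ↔ ∀ ρ ⊆ σ, #ρ = n → ρ ∉ L) ∧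
      (∀ T ∈ ts, ∀ T' ∈ ts, T.order = 0 → T'.order = 0 → T = T') ∧
      ((∃ T ∈ ts, T.order = n + 1) ↔ ∀ ρ ⊆ σ, #ρ = n → ρ ∈ L) ∧
      (∀ T ∈ ts, ∀ T' ∈ ts, T.order = n + 1 → T'.order = n + 1 → T = T') := by
  obtain ⟨W, hWlt, hW⟩ := exists_sorted_words σ
  have hσ0 : σ.Nonempty := card_pos.1 (hσ ▸ n.succ_pos)
  have hWne : ∀ l ∈ W, l ≠ [] := by
    rintro l hl rfl
    exact hσ0.ne_empty ((hW _).1 hl).2.symm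
  have hperm : ∀ l ∈ W, ∀ l' ∈ W, l.Perm l' := fun l hl l' hl' =>
    List.perm_of_nodup_nodup_toFinset_eq ((hW l).1 hl).1 ((hW l').1 hl').1
      (((hW l).1 hl).2.trans ((hW l').1 hl').2.symm)
  have hpermW : ∀ l ∈ W, ∀ l' : List α, l'.Perm l → l' ∈ W := fun l hl l' hp =>
    (hW l').2 ⟨hp.nodup_iff.2 ((hW l).1 hl).1,
      (List.toFinset_eq_of_perm _ _ hp).trans ((hW l).1 hl).2⟩
  have hlen : ∀ l ∈ W, l.length = n + 1 := fun l hl => by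
    rw [← List.toFinset_card_of_nodup ((hW l).1 hl).1, ((hW l).1 hl).2, hσ]
  have hcardflag : ∀ l ∈ W, #(wordFlag l) = n + 1 := fun l hl => by
    rw [card_wordFlag ((hW l).1 hl).1, hlen l hl]
  have hcardtail : ∀ l ∈ W, #(wordFlag l.tail) = n := fun l hl => by
    rw [card_wordFlag ((hW l).1 hl).1.tail, List.length_tail, hlen l hl, Nat.add_sub_cancel]
  have hridges : ∀ ρ ⊆ σ, #ρ = n → ∃ a ∈ σ, ρ = σ.erase a := by
    intro ρ hρ hρn
    obtain ⟨a, ha, hs⟩ := exists_eq_insert_iff.2 ⟨hρ, by rw [hρn, hσ]⟩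
    exact ⟨a, hs ▸ mem_insert_self _ _, by rw [← hs, erase_insert ha]⟩
  have hridge : ∀ l ∈ W, ∃ a m, l = a :: m ∧ m.toFinset = σ.erase a := by
    intro l hl
    obtain ⟨a, m, rfl⟩ := List.exists_cons_of_ne_nil (hWne l hl)
    obtain ⟨hnd, hs⟩ := (hW _).1 hl
    refine ⟨a, m, rfl, ?_⟩
    rw [← hs, List.toFinset_cons, erase_insert]
    simpa using (List.nodup_cons.1 hnd).1
  have hridge_sub : ∀ l ∈ W, l.tail.toFinset ⊆ σ := by
    intro l hl
    obtain ⟨a, m, rfl, hm⟩ := hridge l hl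
    exact hm ▸ erase_subset a σ
  have hridge_card : ∀ l ∈ W, #l.tail.toFinset = n := fun l hl => by
    rw [List.toFinset_card_of_nodup ((hW l).1 hl).1.tail, List.length_tail, hlen l hl,
      Nat.add_sub_cancel]
  have hle : ∀ l ∈ W, ∀ l' ∈ W, wordDescents l ⊆ wordFlag l' → l ≤ l' := fun l hl l' hl' h =>
    le_of_wordDescents_subset ((hW l).1 hl).1 (hperm l' hl' l hl) h
  have : Nonempty (MorseTile (Finset α)) :=
    ⟨⟨{∅}, ∅, none, by simp, by simp, by simp, by simp, by simp⟩⟩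
  choose! T hTs hTr hTf using fun l (hl : l ∈ W) =>
    exists_morseTile_of_word hL (hWne l hl) ((hW l).1 hl).1 (by rw [((hW l).1 hl).2]; exact hLp)
  have hS : ∀ τ, τ ∈ relFaces (barySd σ.powerset) (barySd L) ↔
      ∃ l ∈ W, τ ∈ (T l).faceSet := by
    intro τ
    simp only [relFaces, mem_filter, mem_sdiff, mem_barySd]
    constructor
    · rintro ⟨⟨⟨h1, h2, h3⟩, h4⟩, h5⟩
      obtain ⟨l₀, hl₀, hl₀σ, hτl₀⟩ := exists_word_of_isChain h1 h2 h3
      obtain ⟨l, hl, hmin⟩ := exists_min_image (W.toFinset.filter (fun l => τ ⊆ wordFlag l)) id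
        ⟨l₀, by simp [hW, hl₀, hl₀σ, hτl₀]⟩
      simp only [mem_filter, List.mem_toFinset, id, and_imp] at hl hmin
      refine ⟨l, hl.1, (hTf l hl.1 τ).2 ⟨fun A hA => ?_, hl.2, h5, fun h => h4 ⟨h, h2, h3⟩⟩⟩
      by_contra hAτ
      obtain ⟨l', hlt', hp, hs⟩ := exists_lt_of_mem_wordDescents hA
      exact absurd (hmin l' (hpermW l hl.1 l' hp) ((subset_erase.2 ⟨hl.2, hAτ⟩).trans hs))
        (not_le.2 hlt')
    · rintro ⟨l, hl, h⟩
      obtain ⟨-, h2, h3, h4⟩ := (hTf l hl τ).1 h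
      refine ⟨⟨⟨fun A hA => ?_, fun h => empty_notMem_wordFlag l (h2 h), fun A hA B hB =>
        wordFlag_isChain l A (h2 hA) B (h2 hB)⟩, fun h => h4 h.1⟩, h3⟩
      rw [mem_powerset, ← ((hW l).1 hl).2]
      exact subset_of_mem_wordFlag (h2 hA)
  have hclosed : ∀ τ ∈ relFaces (barySd σ.powerset) (barySd L), ∀ l ∈ W,
      ∀ β ∈ (T l).faceSet, τ ⊆ β → ∃ l' ∈ W, l' ≤ l ∧ τ ∈ (T l').faceSet := by
    intro τ hτ l hl β hβ hτβ
    obtain ⟨l', hl', h'⟩ := (hS τ).1 hτ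
    exact ⟨l', hl', hle l' hl' l hl (((hTf l' hl' τ).1 h').1.trans
      (hτβ.trans ((hTf l hl β).1 hβ).2.1)), h'⟩
  have hfu : faceUnion (W.map T) = relFaces (barySd σ.powerset) (barySd L) := by
    ext τ
    simp [mem_faceUnion, hS]
  have horder : ∀ l ∈ W, (T l).order =
      if l.tail.toFinset ∈ L then #(wordDescents l) + 1 else #(wordDescents l) := by
    intro l hl
    rw [MorseTile.order, hTr l hl]
    split_ifs
    · refine card_insert_of_notMem fun h => ?_
      obtain ⟨a, m, rfl, -⟩ := hridge l hl
      exact toFinset_cons_notMem_wordFlag (List.nodup_cons.1 ((hW _).1 hl).1).1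
        (wordDescents_subset_wordFlag_tail _ h)
    · rfl
  have horder0 : ∀ l ∈ W, (T l).order = 0 →
      wordDescents l = ∅ ∧ l.tail.toFinset ∉ L := by
    intro l hl h
    rw [horder l hl] at h
    split_ifs at h with hr
    exact ⟨card_eq_zero.1 h, hr⟩
  have hordertop : ∀ l ∈ W, (T l).order = n + 1 →
      l.Pairwise (· > ·) ∧ l.tail.toFinset ∈ L := by
    intro l hl h
    have hsub := wordDescents_subset_wordFlag_tail l
    have hcard := card_le_card hsub
    rw [hcardtail l hl] at hcard
    rw [horder l hl] at h
    split_ifs at h with hr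
    · refine ⟨pairwise_gt_of_wordFlag_tail_subset ((hW l).1 hl).1 ?_, hr⟩
      rw [eq_of_subset_of_card_le hsub (by rw [hcardtail l hl]; omega)]
    · omega
  refine ⟨W.map T, ⟨⟨?_, hfu, fun d => ?_⟩, fun p => ?_⟩, ⟨?_, fun h => ?_⟩, ?_,
    ⟨?_, fun h => ?_⟩, ?_⟩
  · refine List.pairwise_map.2 (hWlt.imp_of_mem fun {l l'} hl hl' hll' => ?_)
    refine disjoint_left.2 fun τ hτ hτ' => absurd (hle l' hl' l hl ?_) (not_le.2 hll')
    exact ((hTf l' hl' τ).1 hτ').1.trans ((hTf l hl τ).1 hτ).2.1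
  · intro τ hτ _ β hβ hτβ
    obtain ⟨T₀, hT₀, hβT⟩ := mem_faceUnion.1 hβ
    obtain ⟨hT₀, hd⟩ := List.mem_filter.1 hT₀
    obtain ⟨l, hl, rfl⟩ := List.mem_map.1 hT₀
    obtain ⟨l', hl', -, h'⟩ := hclosed τ hτ l hl β hβT hτβ
    refine mem_faceUnion.2 ⟨T l', List.mem_filter.2 ⟨List.mem_map_of_mem hl', ?_⟩, h'⟩
    rw [MorseTile.dim, hTs l hl, hcardflag l hl] at hd
    rwa [MorseTile.dim, hTs l' hl', hcardflag l' hl']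
  · intro τ hτ _ β hβ hτβ
    rw [← List.map_take] at hβ ⊢
    obtain ⟨T₀, hT₀, hβT⟩ := mem_faceUnion.1 hβ
    obtain ⟨l, hl, rfl⟩ := List.mem_map.1 hT₀
    obtain ⟨l', hl', hl'l, h'⟩ := hclosed τ hτ l (List.mem_of_mem_take hl) β hβT hτβ
    refine mem_faceUnion.2 ⟨T l', List.mem_map_of_mem ?_, h'⟩
    rw [← List.take_append_drop p W] at hWlt hl'
    refine (List.mem_append.1 hl').resolve_right fun hd => ?_
    exact absurd ((List.pairwise_append.1 hWlt).2.2 l hl l' hd) (not_lt.2 hl'l)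
  · rintro ⟨T₀, hT₀, h0⟩ ρ hρ hρn hρL
    obtain ⟨l, hl, rfl⟩ := List.mem_map.1 hT₀
    obtain ⟨hD, hr⟩ := horder0 l hl h0
    obtain ⟨a, m, rfl, hm⟩ := hridge l hl
    obtain ⟨b, hb, rfl⟩ := hridges ρ hρ hρn
    have hba : b < a := hlt b a hρL (by rwa [← hm])
    have hbm : b ∈ m := by
      rw [← List.mem_toFinset, hm]
      exact mem_erase.2 ⟨hba.ne, hb⟩
    obtain ⟨A, hA, -⟩ := exists_mem_wordDescents_of_lt_head hbm hba
    simp [hD] at hA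
  · have hl : σ.sort ∈ W := (hW _).2 ⟨sort_nodup _ _, sort_toFinset _ _⟩
    refine ⟨T σ.sort, List.mem_map_of_mem hl, ?_⟩
    rw [horder _ hl, if_neg (h _ (hridge_sub _ hl) (hridge_card _ hl)),
      wordDescents_eq_empty_of_pairwise_lt (sortedLT_sort σ).pairwise, card_empty]
  · intro T₁ hT₁ T₂ hT₂ h₁ h₂
    obtain ⟨l, hl, rfl⟩ := List.mem_map.1 hT₁
    obtain ⟨l', hl', rfl⟩ := List.mem_map.1 hT₂
    rw [le_antisymm (hle l hl l' hl' (by simp [(horder0 l hl h₁).1]))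
      (hle l' hl' l hl (by simp [(horder0 l' hl' h₂).1]))]
  · rintro ⟨T₀, hT₀, h0⟩ ρ hρ hρn
    obtain ⟨l, hl, rfl⟩ := List.mem_map.1 hT₀
    obtain ⟨hD, hr⟩ := hordertop l hl h0
    obtain ⟨a, m, rfl, hm⟩ := hridge l hl
    obtain ⟨b, hb, rfl⟩ := hridges ρ hρ hρn
    by_contra hbL
    have hab : a < b := hlt a b (by rwa [← hm]) hbL
    have hbm : b ∈ m := by
      rw [← List.mem_toFinset, hm]
      exact mem_erase.2 ⟨hab.ne', hb⟩
    exact lt_asymm hab ((List.pairwise_cons.1 hD).1 b hbm)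
  · have hl : σ.sort (· ≥ ·) ∈ W := (hW _).2 ⟨sort_nodup _ _, sort_toFinset _ _⟩
    refine ⟨_, List.mem_map_of_mem hl, ?_⟩
    rw [horder _ hl, wordDescents_eq_of_pairwise_gt (sortedGT_sort σ).pairwise, hcardtail _ hl,
      if_pos (h _ (hridge_sub _ hl) (hridge_card _ hl))]
  · intro T₁ hT₁ T₂ hT₂ h₁ h₂
    obtain ⟨l, hl, rfl⟩ := List.mem_map.1 hT₁
    obtain ⟨l', hl', rfl⟩ := List.mem_map.1 hT₂
    rw [(hperm l hl l' hl').eq_of_pairwise' (hordertop l hl h₁).1 (hordertop l' hl' h₂).1]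

end Tiles

/-- The elements satisfying a predicate form an initial segment of some linear order. -/
theorem exists_linearOrder_lt_of_pred {α : Type*} (p : α → Prop) :
    ∃ o : LinearOrder α, ∀ a b, p a → ¬ p b → o.lt a b := by
  classical
  let o : LinearOrder α := linearOrderOfSTO WellOrderingRel
  refine ⟨LinearOrder.lift' (fun a => toLex (decide (¬ p a), a)) fun a b h => ?_, ?_⟩
  · simpa using (congrArg (fun x => (ofLex x).2) h)
  · intro a b ha hb
    change toLex (decide (¬ p a), a) < toLex (decide (¬ p b), b)
    rw [Prod.Lex.toLex_lt_toLex]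
    left
    simp [ha, hb]

/-- the first barycentric subdivision of every relative simplex carries
a shellable Morse tiling, with the stated tiles of order `0` and `n+1`. -/
theorem barycentric_subdivision_of_relative_simplex_morse_shellable
    {V : Type*} [DecidableEq V] (n : ℕ) (σ : Finset V) (hσ : σ.card = n + 1)
    (L : Finset (Finset V)) (hL : IsComplex L) (hLσ : L ⊆ σ.powerset) (hLp : σ ∉ L) :
    ∃ ts : List (MorseTile (Finset V)),
      IsMorseShelling (relFaces (barySd σ.powerset) (barySd L)) ts ∧
      ((∃ T ∈ ts, T.order = 0) ↔ ∀ ρ ⊆ σ, ρ.card = n → ρ ∉ L) ∧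
      (∀ T ∈ ts, ∀ T' ∈ ts, T.order = 0 → T'.order = 0 → T = T') ∧
      ((∃ T ∈ ts, T.order = n + 1) ↔ ∀ ρ ⊆ σ, ρ.card = n → ρ ∈ L) ∧
      (∀ T ∈ ts, ∀ T' ∈ ts, T.order = n + 1 → T'.order = n + 1 → T = T') := by
  obtain ⟨o, ho⟩ := exists_linearOrder_lt_of_pred (fun a => σ.erase a ∈ L)
  obtain rfl : ‹DecidableEq V› = o.toDecidableEq := Subsingleton.elim _ _
  exact barySd_simplex_morseShelling n σ hσ L hL hLp ho
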